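/- Let 0 < μ ≤ L, let λ ∈ [μ, L], and let α ∈ [0, 1]. Then (i) the discriminant inequality (αλ/L + √(μ/L))² − 4λ/L ≤ 0 holds, and consequently (ii) every complex root z of the quadratic polynomial z² + (αλ/L + √(μ/L))z + λ/L has real part Re[z] = −(αλ/(2L)) − (1/2)√(μ/L), so in particular Re[z] ≤ −(1/2)√(μ/L). -/

import Mathlib

/-- Every complex root of a monic real quadratic with nonpositive discriminant has real part
`-b / 2`. -/
theorem Complex.re_eq_neg_half_of_quadratic_eq_zero {b c : ℝ} (hd : b ^ 2 - 4 * c ≤ 0) {z : ℂ}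
    (hz : z ^ 2 + (b : ℂ) * z + (c : ℂ) = 0) : z.re = -b / 2 := by
  have hre := congrArg Complex.re hz
  have him := congrArg Complex.im hz
  simp only [pow_two, Complex.add_re, Complex.add_im, Complex.mul_re, Complex.mul_im,
    Complex.ofReal_re, Complex.ofReal_im, Complex.zero_re, Complex.zero_im] at hre him
  have hprod : z.im * (2 * z.re + b) = 0 := by linarith
  rcases mul_eq_zero.mp hprod with hy | hx
  · rw [hy] at hre
    have hsq : (2 * z.re + b) ^ 2 = 0 := le_antisymm (by nlinarith) (sq_nonneg _)
    linarith [pow_eq_zero_iff two_ne_zero |>.mp hsq]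
  · linarith

/-- If `0 ≤ a ≤ t ≤ 1` and `s ≤ t`, then `(a + √s)² ≤ 4t`. -/
theorem sq_add_sqrt_le_four_mul {a s t : ℝ} (ha : 0 ≤ a) (hat : a ≤ t) (hst : s ≤ t)
    (ht : t ≤ 1) : (a + √s) ^ 2 ≤ 4 * t := by
  have ht0 : 0 ≤ t := ha.trans hat
  have hs : √s ≤ √t := Real.sqrt_le_sqrt hst
  have har : a ≤ √t := hat.trans (Real.le_sqrt_of_sq_le (by nlinarith))
  calc (a + √s) ^ 2 ≤ (2 * √t) ^ 2 := by gcongr; linarith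
    _ = 4 * t := by rw [mul_pow, Real.sq_sqrt ht0]; norm_num

/-- For `0 < μ ≤ L`, `λ ∈ [μ, L]`, `α ∈ [0, 1]`:
(i) `(αλ/L + √(μ/L))² − 4λ/L ≤ 0`, and (ii) every complex root `z` of
`z² + (αλ/L + √(μ/L))z + λ/L` has `Re z = −αλ/(2L) − (1/2)√(μ/L)`, so in particular
`Re z ≤ −(1/2)√(μ/L)`. -/
theorem agm_block_root_bound (μ L lam α : ℝ)
    (hμ : 0 < μ) (hμL : μ ≤ L) (hlam : lam ∈ Set.Icc μ L) (hα : α ∈ Set.Icc (0 : ℝ) 1) :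
    ((α * lam / L + Real.sqrt (μ / L)) ^ 2 - 4 * lam / L ≤ 0) ∧
    ∀ z : ℂ, z ^ 2 + (↑(α * lam / L + Real.sqrt (μ / L)) : ℂ) * z + (↑(lam / L) : ℂ) = 0 →
      z.re = -(α * lam / (2 * L)) - (1/2) * Real.sqrt (μ / L) ∧
      z.re ≤ -((1/2) * Real.sqrt (μ / L)) := by
  obtain ⟨hμlam, hlamL⟩ := hlam
  obtain ⟨hα0, hα1⟩ := hα
  have hL : 0 < L := hμ.trans_le hμL
  have hlam0 : 0 < lam := hμ.trans_le hμlam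
  have ha : 0 ≤ α * lam / L := by positivity
  have hat : α * lam / L ≤ lam / L := by
    gcongr
    exact mul_le_of_le_one_left hlam0.le hα1
  have hst : μ / L ≤ lam / L := by gcongr
  have hdisc := sq_add_sqrt_le_four_mul ha hat hst ((div_le_one hL).mpr hlamL)
  refine ⟨by rw [mul_div_assoc 4]; linarith, fun z hz => ?_⟩
  have hre := Complex.re_eq_neg_half_of_quadratic_eq_zero (sub_nonpos.mpr hdisc) hz
  have hhalf : α * lam / (2 * L) = α * lam / L / 2 := by rw [mul_comm 2 L, div_div]
  constructor <;> linarith
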